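/- (Main Theorem, connection variation / Yang's equation.) Suppose ∂₁²f + ∂₂²f is a constant function on ℝ⁴. Let Γ be the full connection of the generalised pp-wave with purely axial torsion, and for real connection coefficients A^κ_{μν} define the Yang–Mills Lagrangian density q[A] = R[A]^κ_{λμν} R[A]^λ_{καβ} g^{μα} g^{νβ} (note √|det g| = 1). Then the action is stationary at Γ under compactly supported variations of the connection: for every smooth compactly supported B^κ_{μν} : ℝ⁴ → ℝ, the function t ↦ ∫_{ℝ⁴} ( q[Γ + tB] − q[Γ] ) dx (Lebesgue integral; the integrand is compactly supported) is differentiable at t = 0 with derivative 0. -/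

import Mathlib

noncomputable section

open scoped BigOperators

/-- Points of spacetime: ℝ⁴ with coordinates x⁰, x¹, x², x³. -/
abbrev Spacetime := Fin 4 → ℝ

/-- Partial derivative ∂_μ of a scalar function. -/
def pd (μ : Fin 4) (h : Spacetime → ℝ) : Spacetime → ℝ :=
  fun x => fderiv ℝ h x (Pi.single μ 1)

/-- The pp-metric g_{μν}: nonzero components g₀₃ = g₃₀ = 1, g₁₁ = g₂₂ = −1, g₃₃ = f. -/
def ppMetric (f : Spacetime → ℝ) (x : Spacetime) (μ ν : Fin 4) : ℝ :=
  if μ = 0 ∧ ν = 3 then 1 else if μ = 3 ∧ ν = 0 then 1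
  else if μ = 1 ∧ ν = 1 then -1 else if μ = 2 ∧ ν = 2 then -1
  else if μ = 3 ∧ ν = 3 then f x else 0

/-- The pointwise inverse metric g^{μν}: g⁰⁰ = −f, g⁰³ = g³⁰ = 1, g¹¹ = g²² = −1. -/
def ppMetricInv (f : Spacetime → ℝ) (x : Spacetime) (μ ν : Fin 4) : ℝ :=
  if μ = 0 ∧ ν = 0 then -(f x) else if μ = 0 ∧ ν = 3 then 1
  else if μ = 3 ∧ ν = 0 then 1
  else if μ = 1 ∧ ν = 1 then -1 else if μ = 2 ∧ ν = 2 then -1 else 0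

/-- Christoffel symbols {Γ}^λ_{μν} = ½ g^{λκ}(∂_μ g_{κν} + ∂_ν g_{κμ} − ∂_κ g_{μν}). -/
def christoffel (f : Spacetime → ℝ) (x : Spacetime) (l μ ν : Fin 4) : ℝ :=
  (1/2) * ∑ κ, ppMetricInv f x l κ *
    (pd μ (fun y => ppMetric f y κ ν) x + pd ν (fun y => ppMetric f y κ μ) x
      - pd κ (fun y => ppMetric f y μ ν) x)

/-- Totally antisymmetric symbol ε with ε₀₁₂₃ = 1. -/
def eps (a b c d : Fin 4) : ℝ :=
  ((((b:ℕ):ℝ) - ((a:ℕ):ℝ)) * (((c:ℕ):ℝ) - ((a:ℕ):ℝ)) * (((d:ℕ):ℝ) - ((a:ℕ):ℝ)) *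
    (((c:ℕ):ℝ) - ((b:ℕ):ℝ)) * (((d:ℕ):ℝ) - ((b:ℕ):ℝ)) * (((d:ℕ):ℝ) - ((c:ℕ):ℝ))) / 12

/-- Purely axial torsion T_{κμν} = k(x³) ε_{0κμν}. -/
def torsion (k : ℝ → ℝ) (x : Spacetime) (κ μ ν : Fin 4) : ℝ :=
  k (x 3) * eps 0 κ μ ν

/-- Contorsion K^κ_{μν} = ½ g^{κρ} T_{ρμν}. -/
def contorsion (f : Spacetime → ℝ) (k : ℝ → ℝ) (x : Spacetime) (κ μ ν : Fin 4) : ℝ :=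
  (1/2) * ∑ ρ, ppMetricInv f x κ ρ * torsion k x ρ μ ν

/-- The full connection Γ^λ_{μν} = {Γ}^λ_{μν} + K^λ_{μν}. -/
def fullConn (f : Spacetime → ℝ) (k : ℝ → ℝ) (x : Spacetime) (κ μ ν : Fin 4) : ℝ :=
  christoffel f x κ μ ν + contorsion f k x κ μ ν

/-- Curvature R[A]^κ_{λμν} of connection coefficients A^κ_{μν}. -/
def curv (A : Spacetime → Fin 4 → Fin 4 → Fin 4 → ℝ) (x : Spacetime)
    (κ l μ ν : Fin 4) : ℝ :=
  pd μ (fun y => A y κ ν l) x - pd ν (fun y => A y κ μ l) x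
    + ∑ η, (A x κ μ η * A x η ν l - A x κ ν η * A x η μ l)

/-- The parallel null vector field l^μ = (1,0,0,0). -/
def lUp : Fin 4 → ℝ := fun μ => if μ = 0 then 1 else 0

/-- The lowered vector l_μ = g_{μν} l^ν = (0,0,0,1). -/
def lCov : Fin 4 → ℝ := fun μ => if μ = 3 then 1 else 0

open MeasureTheory

/-- Yang–Mills Lagrangian density q[A] = R[A]^κ_{λμν} R[A]^λ_{καβ} g^{μα} g^{νβ}
(here √|det g| = 1). -/
def qYM (f : Spacetime → ℝ) (A : Spacetime → Fin 4 → Fin 4 → Fin 4 → ℝ)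
    (x : Spacetime) : ℝ :=
  ∑ κ, ∑ lam, ∑ μ, ∑ ν, ∑ α, ∑ β,
    curv A x κ lam μ ν * curv A x lam κ α β * ppMetricInv f x μ α * ppMetricInv f x ν β

lemma contDiff_pd {h : Spacetime → ℝ} (hh : ContDiff ℝ (⊤ : ℕ∞) h) (μ : Fin 4) :
    ContDiff ℝ (⊤ : ℕ∞) (pd μ h) :=
  (hh.fderiv_right (m := (⊤ : ℕ∞)) (by exact_mod_cast le_rfl)).clm_apply contDiff_const

lemma pd_const (μ : Fin 4) (c : ℝ) (x : Spacetime) : pd μ (fun _ => c) x = 0 := by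
  simp [pd]

lemma pd_add {g h : Spacetime → ℝ} {x : Spacetime} (μ : Fin 4) (hg : DifferentiableAt ℝ g x)
    (hh : DifferentiableAt ℝ h x) : pd μ (fun y => g y + h y) x = pd μ g x + pd μ h x := by
  simp [pd, fderiv_fun_add hg hh]

lemma pd_neg {g : Spacetime → ℝ} {x : Spacetime} (μ : Fin 4) :
    pd μ (fun y => -g y) x = -pd μ g x := by
  simp [pd, fderiv_fun_neg]

lemma pd_mul {g h : Spacetime → ℝ} {x : Spacetime} (μ : Fin 4) (hg : DifferentiableAt ℝ g x)
    (hh : DifferentiableAt ℝ h x) :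
    pd μ (fun y => g y * h y) x = g x * pd μ h x + h x * pd μ g x := by
  simp [pd, fderiv_fun_mul hg hh]

lemma pd_const_mul {g : Spacetime → ℝ} {x : Spacetime} (μ : Fin 4) (c : ℝ)
    (hg : DifferentiableAt ℝ g x) : pd μ (fun y => c * g y) x = c * pd μ g x := by
  rw [pd_mul μ (differentiableAt_const c) hg, pd_const]
  ring

lemma pd_comm {h : Spacetime → ℝ} (hh : ContDiff ℝ (⊤ : ℕ∞) h) (μ ν : Fin 4) (x : Spacetime) :
    pd μ (pd ν h) x = pd ν (pd μ h) x := by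
  have hd : DifferentiableAt ℝ (fderiv ℝ h) x :=
    (hh.fderiv_right (m := (⊤ : ℕ∞)) (by exact_mod_cast le_rfl)).differentiable (by simp) x
  have key : ∀ α β : Fin 4, pd α (pd β h) x
      = fderiv ℝ (fderiv ℝ h) x (Pi.single α 1) (Pi.single β 1) := by
    intro α β
    unfold pd
    rw [fderiv_clm_apply hd (differentiableAt_const _)]
    simp
  rw [key, key]
  refine hh.contDiffAt.isSymmSndFDerivAt ?_ _ _
  rw [minSmoothness_of_isRCLikeNormedField]
  exact WithTop.coe_le_coe.mpr le_top

lemma pd_comp_coord {k : ℝ → ℝ} (hk : Differentiable ℝ k) {μ ν : Fin 4} (h : μ ≠ ν)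
    (x : Spacetime) : pd μ (fun y => k (y ν)) x = 0 := by
  have h1 : HasFDerivAt (fun y : Spacetime => y ν)
      (ContinuousLinearMap.proj (R := ℝ) (φ := fun _ : Fin 4 => ℝ) ν) x :=
    (ContinuousLinearMap.proj (R := ℝ) (φ := fun _ : Fin 4 => ℝ) ν).hasFDerivAt
  have h2 := (hk (x ν)).hasDerivAt.comp_hasFDerivAt x h1
  unfold pd
  rw [show (fun y : Spacetime => k (y ν)) = k ∘ fun y => y ν from rfl, h2.fderiv]
  simp [Ne.symm h]

lemma integrable_pd {h : Spacetime → ℝ} (hh : ContDiff ℝ (⊤ : ℕ∞) h)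
    (hc : HasCompactSupport h) (μ : Fin 4) : Integrable (fun x => pd μ h x) :=
  (contDiff_pd hh μ).continuous.integrable_of_hasCompactSupport (hc.fderiv_apply ℝ _)

/-- The integral of a partial derivative of a compactly supported function vanishes. -/
lemma integral_pd_eq_zero {h : Spacetime → ℝ} (hh : ContDiff ℝ (⊤ : ℕ∞) h)
    (hc : HasCompactSupport h) (μ : Fin 4) : ∫ x, pd μ h x = 0 := by
  have := integral_mul_fderiv_eq_neg_fderiv_mul_of_integrable (μ := volume) (𝕜 := ℝ)
    (f := fun _ : Spacetime => (1 : ℝ)) (g := h) (v := Pi.single μ 1) (by simp)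
    (by simpa only [one_mul, pd] using integrable_pd hh hc μ)
    (by simpa only [one_mul] using hh.continuous.integrable_of_hasCompactSupport hc)
    (fun _ _ => differentiableAt_const _) (fun x _ => hh.differentiable (by simp) x)
  simpa [pd] using this

/-- The first-order variation of the curvature at `A` in the direction `B`. -/
def curvLin (A B : Spacetime → Fin 4 → Fin 4 → Fin 4 → ℝ) (x : Spacetime)
    (κ l μ ν : Fin 4) : ℝ :=
  pd μ (fun y => B y κ ν l) x - pd ν (fun y => B y κ μ l) x
    + ∑ η, (A x κ μ η * B x η ν l + B x κ μ η * A x η ν l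
      - A x κ ν η * B x η μ l - B x κ ν η * A x η μ l)

/-- The second-order variation of the curvature in the direction `B`. -/
def curvQuad (B : Spacetime → Fin 4 → Fin 4 → Fin 4 → ℝ) (x : Spacetime)
    (κ l μ ν : Fin 4) : ℝ :=
  ∑ η, (B x κ μ η * B x η ν l - B x κ ν η * B x η μ l)

lemma curv_add_smul {A B : Spacetime → Fin 4 → Fin 4 → Fin 4 → ℝ}
    (hA : ∀ κ μ ν, ContDiff ℝ (⊤ : ℕ∞) (fun x => A x κ μ ν))
    (hB : ∀ κ μ ν, ContDiff ℝ (⊤ : ℕ∞) (fun x => B x κ μ ν)) (t : ℝ) (x : Spacetime)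
    (κ l μ ν : Fin 4) :
    curv (fun y κ μ ν => A y κ μ ν + t * B y κ μ ν) x κ l μ ν
      = curv A x κ l μ ν + t * curvLin A B x κ l μ ν + t ^ 2 * curvQuad B x κ l μ ν := by
  have dA : ∀ κ μ ν, DifferentiableAt ℝ (fun x => A x κ μ ν) x :=
    fun κ μ ν => (hA κ μ ν).differentiable (by simp) x
  have dB : ∀ κ μ ν, DifferentiableAt ℝ (fun x => B x κ μ ν) x :=
    fun κ μ ν => (hB κ μ ν).differentiable (by simp) x
  have e : ∀ α κ μ ν, pd α (fun y => A y κ μ ν + t * B y κ μ ν) x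
      = pd α (fun y => A y κ μ ν) x + t * pd α (fun y => B y κ μ ν) x := by
    intro α κ μ ν
    rw [pd_add α (dA κ μ ν) ((dB κ μ ν).const_mul t), pd_const_mul α t (dB κ μ ν)]
  simp only [curv, curvLin, curvQuad, e, Fin.sum_univ_four]
  ring

/-- The bilinear pairing of curvature-type tensors underlying the Yang–Mills density. -/
def ymPair (f : Spacetime → ℝ) (x : Spacetime) (F G : Fin 4 → Fin 4 → Fin 4 → Fin 4 → ℝ) : ℝ :=
  ∑ κ, ∑ lam, ∑ μ, ∑ ν, ∑ α, ∑ β,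
    F κ lam μ ν * G lam κ α β * ppMetricInv f x μ α * ppMetricInv f x ν β

lemma ymPair_expand (f : Spacetime → ℝ) (x : Spacetime)
    (F L Q : Fin 4 → Fin 4 → Fin 4 → Fin 4 → ℝ) (t : ℝ) :
    ymPair f x (fun κ l μ ν => F κ l μ ν + t * L κ l μ ν + t ^ 2 * Q κ l μ ν)
        (fun κ l μ ν => F κ l μ ν + t * L κ l μ ν + t ^ 2 * Q κ l μ ν)
      = ymPair f x F F + (t * (ymPair f x F L + ymPair f x L F)
        + t ^ 2 * (ymPair f x F Q + ymPair f x L L + ymPair f x Q F)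
        + t ^ 3 * (ymPair f x L Q + ymPair f x Q L) + t ^ 4 * ymPair f x Q Q) := by
  simp only [ymPair, Finset.mul_sum, ← Finset.sum_add_distrib]
  refine Finset.sum_congr rfl fun _ _ => Finset.sum_congr rfl fun _ _ =>
    Finset.sum_congr rfl fun _ _ => Finset.sum_congr rfl fun _ _ =>
    Finset.sum_congr rfl fun _ _ => Finset.sum_congr rfl fun _ _ => ?_
  ring

lemma contDiff_ppMetricInv {f : Spacetime → ℝ} (hf : ContDiff ℝ (⊤ : ℕ∞) f) (μ ν : Fin 4) :
    ContDiff ℝ (⊤ : ℕ∞) (fun x => ppMetricInv f x μ ν) := by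
  unfold ppMetricInv
  split_ifs <;> fun_prop

lemma continuous_ymPair {f : Spacetime → ℝ} (hf : ContDiff ℝ (⊤ : ℕ∞) f)
    {F G : Spacetime → Fin 4 → Fin 4 → Fin 4 → Fin 4 → ℝ}
    (hF : ∀ κ l μ ν, Continuous fun x => F x κ l μ ν)
    (hG : ∀ κ l μ ν, Continuous fun x => G x κ l μ ν) :
    Continuous fun x => ymPair f x (F x) (G x) := by
  have := fun μ ν => (contDiff_ppMetricInv hf μ ν).continuous
  unfold ymPair
  fun_prop

lemma ymPair_zero_left (f : Spacetime → ℝ) (x : Spacetime)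
    (G : Fin 4 → Fin 4 → Fin 4 → Fin 4 → ℝ) : ymPair f x 0 G = 0 := by
  simp [ymPair]

lemma ymPair_zero_right (f : Spacetime → ℝ) (x : Spacetime)
    (F : Fin 4 → Fin 4 → Fin 4 → Fin 4 → ℝ) : ymPair f x F 0 = 0 := by
  simp [ymPair]

lemma pd_eq_zero_of_notMem_tsupport {B : Spacetime → Fin 4 → Fin 4 → Fin 4 → ℝ} {x : Spacetime}
    (hx : x ∉ tsupport B) (α κ μ ν : Fin 4) : pd α (fun y => B y κ μ ν) x = 0 := by
  have h : (fun y => B y κ μ ν) =ᶠ[nhds x] fun _ => 0 := by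
    filter_upwards [notMem_tsupport_iff_eventuallyEq.mp hx] with y hy
    simp [hy]
  simp [pd, h.fderiv_eq]

lemma curvLin_eq_zero (A : Spacetime → Fin 4 → Fin 4 → Fin 4 → ℝ)
    {B : Spacetime → Fin 4 → Fin 4 → Fin 4 → ℝ} {x : Spacetime} (hx : x ∉ tsupport B) :
    curvLin A B x = 0 := by
  funext κ l μ ν
  simp [curvLin, pd_eq_zero_of_notMem_tsupport hx, image_eq_zero_of_notMem_tsupport hx]

lemma curvQuad_eq_zero {B : Spacetime → Fin 4 → Fin 4 → Fin 4 → ℝ} {x : Spacetime}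
    (hx : x ∉ tsupport B) : curvQuad B x = 0 := by
  funext κ l μ ν
  simp [curvQuad, image_eq_zero_of_notMem_tsupport hx]

lemma hasDerivAt_integral_quartic {X : Type*} [MeasurableSpace X] {m : Measure X}
    {g₁ g₂ g₃ g₄ : X → ℝ} (h₁ : Integrable g₁ m) (h₂ : Integrable g₂ m) (h₃ : Integrable g₃ m)
    (h₄ : Integrable g₄ m) (h : ∫ x, g₁ x ∂m = 0) :
    HasDerivAt (fun t : ℝ => ∫ x, (t * g₁ x + t ^ 2 * g₂ x + t ^ 3 * g₃ x + t ^ 4 * g₄ x) ∂m)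
      0 0 := by
  have e : ∀ t : ℝ, ∫ x, (t * g₁ x + t ^ 2 * g₂ x + t ^ 3 * g₃ x + t ^ 4 * g₄ x) ∂m
      = t ^ 2 * ∫ x, g₂ x ∂m + t ^ 3 * ∫ x, g₃ x ∂m + t ^ 4 * ∫ x, g₄ x ∂m := by
    intro t
    have j₂ : Integrable (fun x => t * g₁ x + t ^ 2 * g₂ x) m :=
      (h₁.const_mul t).add (h₂.const_mul _)
    have j₃ : Integrable (fun x => t * g₁ x + t ^ 2 * g₂ x + t ^ 3 * g₃ x) m :=
      j₂.add (h₃.const_mul _)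
    rw [integral_add j₃ (h₄.const_mul _), integral_add j₂ (h₃.const_mul _),
      integral_add (h₁.const_mul t) (h₂.const_mul _)]
    simp only [integral_const_mul, h, mul_zero, zero_add]
  simp only [e]
  have d₂ := (hasDerivAt_pow 2 (0 : ℝ)).mul_const (∫ x, g₂ x ∂m)
  have d₃ := (hasDerivAt_pow 3 (0 : ℝ)).mul_const (∫ x, g₃ x ∂m)
  have d₄ := (hasDerivAt_pow 4 (0 : ℝ)).mul_const (∫ x, g₄ x ∂m)
  refine ((d₂.add d₃).add d₄).congr_deriv ?_
  norm_num

/-- If the integrated first-order term vanishes, the Yang–Mills action is stationary. -/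
lemma hasDerivAt_action {f : Spacetime → ℝ} (hf : ContDiff ℝ (⊤ : ℕ∞) f)
    {A B : Spacetime → Fin 4 → Fin 4 → Fin 4 → ℝ}
    (hA : ∀ κ μ ν, ContDiff ℝ (⊤ : ℕ∞) (fun x => A x κ μ ν))
    (hB : ∀ κ μ ν, ContDiff ℝ (⊤ : ℕ∞) (fun x => B x κ μ ν)) (hBc : HasCompactSupport B)
    (h : ∫ x, (ymPair f x (curv A x) (curvLin A B x) + ymPair f x (curvLin A B x) (curv A x)) = 0) :
    HasDerivAt (fun t : ℝ => ∫ x : Spacetime,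
      (qYM f (fun y κ μ ν => A y κ μ ν + t * B y κ μ ν) x - qYM f A x)) 0 0 := by
  have cA := fun κ μ ν => (hA κ μ ν).continuous
  have cB := fun κ μ ν => (hB κ μ ν).continuous
  have cA' := fun α κ μ ν => (contDiff_pd (hA κ μ ν) α).continuous
  have cB' := fun α κ μ ν => (contDiff_pd (hB κ μ ν) α).continuous
  have cF : ∀ κ l μ ν, Continuous fun x => curv A x κ l μ ν := by
    intro κ l μ ν
    unfold curv
    fun_prop
  have cL : ∀ κ l μ ν, Continuous fun x => curvLin A B x κ l μ ν := by
    intro κ l μ ν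
    unfold curvLin
    fun_prop
  have cQ : ∀ κ l μ ν, Continuous fun x => curvQuad B x κ l μ ν := by
    intro κ l μ ν
    unfold curvQuad
    fun_prop
  have int : ∀ {g : Spacetime → ℝ}, Continuous g → (∀ x, x ∉ tsupport B → g x = 0) →
      Integrable g := fun hg h0 =>
    hg.integrable_of_hasCompactSupport (HasCompactSupport.intro hBc.isCompact h0)
  have i1 : Integrable fun x =>
      ymPair f x (curv A x) (curvLin A B x) + ymPair f x (curvLin A B x) (curv A x) :=
    int ((continuous_ymPair hf cF cL).add (continuous_ymPair hf cL cF)) fun x hx => by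
      simp [curvLin_eq_zero A hx, ymPair_zero_left, ymPair_zero_right]
  have i2 : Integrable fun x => ymPair f x (curv A x) (curvQuad B x)
      + ymPair f x (curvLin A B x) (curvLin A B x) + ymPair f x (curvQuad B x) (curv A x) :=
    int (((continuous_ymPair hf cF cQ).add (continuous_ymPair hf cL cL)).add
      (continuous_ymPair hf cQ cF)) fun x hx => by
      simp [curvLin_eq_zero A hx, curvQuad_eq_zero hx, ymPair_zero_left, ymPair_zero_right]
  have i3 : Integrable fun x =>
      ymPair f x (curvLin A B x) (curvQuad B x) + ymPair f x (curvQuad B x) (curvLin A B x) :=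
    int ((continuous_ymPair hf cL cQ).add (continuous_ymPair hf cQ cL)) fun x hx => by
      simp [curvLin_eq_zero A hx, ymPair_zero_left, ymPair_zero_right]
  have i4 : Integrable fun x => ymPair f x (curvQuad B x) (curvQuad B x) :=
    int (continuous_ymPair hf cQ cQ) fun x hx => by
      simp [curvQuad_eq_zero hx, ymPair_zero_left]
  have expand : ∀ t x, qYM f (fun y κ μ ν => A y κ μ ν + t * B y κ μ ν) x - qYM f A x
      = t * (ymPair f x (curv A x) (curvLin A B x) + ymPair f x (curvLin A B x) (curv A x))
        + t ^ 2 * (ymPair f x (curv A x) (curvQuad B x)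
          + ymPair f x (curvLin A B x) (curvLin A B x) + ymPair f x (curvQuad B x) (curv A x))
        + t ^ 3 * (ymPair f x (curvLin A B x) (curvQuad B x)
          + ymPair f x (curvQuad B x) (curvLin A B x))
        + t ^ 4 * ymPair f x (curvQuad B x) (curvQuad B x) := by
    intro t x
    change ymPair f x (fun κ l μ ν => curv _ x κ l μ ν) (fun κ l μ ν => curv _ x κ l μ ν)
      - ymPair f x (curv A x) (curv A x) = _
    simp only [curv_add_smul hA hB t x]
    rw [ymPair_expand]
    ring
  simp only [expand]
  exact hasDerivAt_integral_quartic i1 i2 i3 i4 h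

lemma contDiff_fullConn {f : Spacetime → ℝ} (hf : ContDiff ℝ (⊤ : ℕ∞) f) {k : ℝ → ℝ}
    (hk : ContDiff ℝ (⊤ : ℕ∞) k) (κ μ ν : Fin 4) :
    ContDiff ℝ (⊤ : ℕ∞) (fun x => fullConn f k x κ μ ν) := by
  have hg := contDiff_ppMetricInv hf
  have hm : ∀ μ ν, ContDiff ℝ (⊤ : ℕ∞) (fun x => ppMetric f x μ ν) := by
    intro μ ν
    unfold ppMetric
    split_ifs <;> fun_prop
  have hm' := fun α μ ν => contDiff_pd (hm μ ν) α
  unfold fullConn christoffel contorsion torsion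
  fun_prop

lemma pd_ppMetric (f : Spacetime → ℝ) (x : Spacetime) (α μ ν : Fin 4) :
    pd α (fun y => ppMetric f y μ ν) x = if μ = 3 ∧ ν = 3 then pd α f x else 0 := by
  fin_cases μ <;> fin_cases ν <;> simp [ppMetric, pd]

/-- The components of the connection of the generalised pp-wave, as matrices indexed by the
differentiation index. -/
def ppConnMatrix (f : Spacetime → ℝ) (k : ℝ → ℝ) (x : Spacetime) :
    Fin 4 → Matrix (Fin 4) (Fin 4) ℝ :=
  ![0,
    !![0, 0, k (x 3) / 2, pd 1 f x / 2; 0, 0, 0, 0; 0, 0, 0, k (x 3) / 2; 0, 0, 0, 0],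
    !![0, -(k (x 3) / 2), 0, pd 2 f x / 2; 0, 0, 0, -(k (x 3) / 2); 0, 0, 0, 0; 0, 0, 0, 0],
    !![0, pd 1 f x / 2, pd 2 f x / 2, pd 3 f x / 2; 0, 0, k (x 3) / 2, pd 1 f x / 2;
      0, -(k (x 3) / 2), 0, pd 2 f x / 2; 0, 0, 0, 0]]

lemma fullConn_eq {f : Spacetime → ℝ} (h0 : ∀ x, pd 0 f x = 0) (k : ℝ → ℝ) (x : Spacetime)
    (κ μ ν : Fin 4) : fullConn f k x κ μ ν = ppConnMatrix f k x μ κ ν := by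
  simp only [fullConn, christoffel, contorsion, torsion, pd_ppMetric]
  fin_cases κ <;> fin_cases μ <;> fin_cases ν <;>
    simp [ppMetricInv, ppConnMatrix, eps, Fin.sum_univ_four, h0] <;> ring

lemma pd_fullConn {f : Spacetime → ℝ} (h0 : ∀ x, pd 0 f x = 0) {k : ℝ → ℝ}
    (x : Spacetime) (α κ μ ν : Fin 4) :
    pd α (fun y => fullConn f k y κ μ ν) x
      = (![0,
        !![0, 0, pd α (fun y => k (y 3)) x / 2, pd α (pd 1 f) x / 2; 0, 0, 0, 0;
          0, 0, 0, pd α (fun y => k (y 3)) x / 2; 0, 0, 0, 0],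
        !![0, -(pd α (fun y => k (y 3)) x / 2), 0, pd α (pd 2 f) x / 2;
          0, 0, 0, -(pd α (fun y => k (y 3)) x / 2); 0, 0, 0, 0; 0, 0, 0, 0],
        !![0, pd α (pd 1 f) x / 2, pd α (pd 2 f) x / 2, pd α (pd 3 f) x / 2;
          0, 0, pd α (fun y => k (y 3)) x / 2, pd α (pd 1 f) x / 2;
          0, -(pd α (fun y => k (y 3)) x / 2), 0, pd α (pd 2 f) x / 2; 0, 0, 0, 0]] :
        Fin 4 → Matrix (Fin 4) (Fin 4) ℝ) μ κ ν := by
  have half : ∀ g : Spacetime → ℝ, pd α (fun y => g y / 2) x = pd α g x / 2 := by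
    intro g
    rw [show (fun y => g y / 2) = (2⁻¹ : ℝ) • g by ext y; simp [div_eq_inv_mul]]
    simp [pd, fderiv_const_smul_field, div_eq_inv_mul]
  simp only [fullConn_eq h0]
  fin_cases μ <;> fin_cases κ <;> fin_cases ν <;>
    simp [ppConnMatrix, pd_const, pd_neg, half]

/-- The matrix of a null rotation with coefficients `a`, `b`. -/
def nullRot (a b : ℝ) : Matrix (Fin 4) (Fin 4) ℝ :=
  !![0, a, b, 0; 0, 0, 0, a; 0, 0, 0, b; 0, 0, 0, 0]

/-- The tensor whose only components are `p` in the `3 1` plane and `q` in the `3 2` plane. -/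
def nullCurv (p q : Matrix (Fin 4) (Fin 4) ℝ) (κ l μ ν : Fin 4) : ℝ :=
  (!![0, 0, 0, 0; 0, 0, 0, -p κ l; 0, 0, 0, -q κ l; 0, p κ l, q κ l, 0] :
    Matrix (Fin 4) (Fin 4) ℝ) μ ν

/-- The diagonal null rotation coefficients of the curvature of the generalised pp-wave. -/
def curvDiag (f : Spacetime → ℝ) (k : ℝ → ℝ) (i : Fin 4) (x : Spacetime) : ℝ :=
  k (x 3) ^ 2 / 4 - pd i (pd i f) x / 2

/-- The off-diagonal null rotation coefficients of the curvature of the generalised pp-wave. -/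
def curvOff (f : Spacetime → ℝ) (k : ℝ → ℝ) (s : ℝ) (x : Spacetime) : ℝ :=
  s * pd 3 (fun y => k (y 3)) x / 2 - pd 1 (pd 2 f) x / 2

set_option maxHeartbeats 4000000 in
lemma curv_fullConn {f : Spacetime → ℝ} (hf : ContDiff ℝ (⊤ : ℕ∞) f) (h0 : ∀ x, pd 0 f x = 0)
    {k : ℝ → ℝ} (hk : ContDiff ℝ (⊤ : ℕ∞) k) (x : Spacetime) :
    curv (fullConn f k) x = nullCurv (nullRot (curvDiag f k 1 x) (curvOff f k 1 x))
      (nullRot (curvOff f k (-1) x) (curvDiag f k 2 x)) := by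
  funext κ l μ ν
  have h0' : pd 0 f = fun _ => 0 := funext h0
  have z : ∀ i, pd 0 (pd i f) x = 0 := fun i => by rw [pd_comm hf, h0', pd_const]
  have k0 := pd_comp_coord (hk.differentiable (by simp)) (show (0 : Fin 4) ≠ 3 by decide) x
  have k1 := pd_comp_coord (hk.differentiable (by simp)) (show (1 : Fin 4) ≠ 3 by decide) x
  have k2 := pd_comp_coord (hk.differentiable (by simp)) (show (2 : Fin 4) ≠ 3 by decide) x
  simp only [curv, pd_fullConn h0]
  simp only [fullConn_eq h0]
  rw [Fin.sum_univ_four]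
  fin_cases μ <;> fin_cases ν <;> fin_cases κ <;> fin_cases l <;>
    simp [ppConnMatrix, nullRot, nullCurv, curvDiag, curvOff, z, k0, k1, k2,
      pd_comm hf 3 1 x, pd_comm hf 3 2 x, pd_comm hf 2 1 x] <;> ring

lemma contDiff_comp_coord {k : ℝ → ℝ} (hk : ContDiff ℝ (⊤ : ℕ∞) k) (i : Fin 4) :
    ContDiff ℝ (⊤ : ℕ∞) (fun y : Spacetime => k (y i)) :=
  hk.comp (contDiff_apply ℝ ℝ i)

lemma contDiff_curvDiag {f : Spacetime → ℝ} (hf : ContDiff ℝ (⊤ : ℕ∞) f) {k : ℝ → ℝ}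
    (hk : ContDiff ℝ (⊤ : ℕ∞) k) (i : Fin 4) : ContDiff ℝ (⊤ : ℕ∞) (curvDiag f k i) := by
  have h1 := contDiff_pd (contDiff_pd hf i) i
  have h2 := contDiff_comp_coord hk 3
  unfold curvDiag
  fun_prop

lemma contDiff_curvOff {f : Spacetime → ℝ} (hf : ContDiff ℝ (⊤ : ℕ∞) f) {k : ℝ → ℝ}
    (hk : ContDiff ℝ (⊤ : ℕ∞) k) (s : ℝ) : ContDiff ℝ (⊤ : ℕ∞) (curvOff f k s) := by
  have h1 := contDiff_pd (contDiff_pd hf 2) 1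
  have h2 := contDiff_pd (contDiff_comp_coord hk 3) 3
  unfold curvOff
  fun_prop

lemma pd_curvDiag {f : Spacetime → ℝ} (hf : ContDiff ℝ (⊤ : ℕ∞) f) {k : ℝ → ℝ}
    (hk : ContDiff ℝ (⊤ : ℕ∞) k) {α : Fin 4} (hα : α ≠ 3) (i : Fin 4) (x : Spacetime) :
    pd α (curvDiag f k i) x = -(1 / 2) * pd α (pd i (pd i f)) x := by
  have h1 := (contDiff_pd (contDiff_pd hf i) i).differentiable (by simp) x
  have e : curvDiag f k i
      = fun y => (fun r => k r ^ 2 / 4) (y 3) + -(1 / 2) * pd i (pd i f) y := by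
    funext y
    simp only [curvDiag]
    ring
  have h3 : ContDiff ℝ (⊤ : ℕ∞) fun r => k r ^ 2 / 4 := by fun_prop
  rw [e, pd_add α ((contDiff_comp_coord h3 3).differentiable (by simp) x) (h1.const_mul _),
    pd_const_mul α _ h1, pd_comp_coord (h3.differentiable (by simp)) hα, zero_add]

lemma pd_curvOff {f : Spacetime → ℝ} (hf : ContDiff ℝ (⊤ : ℕ∞) f) {k : ℝ → ℝ}
    (hk : ContDiff ℝ (⊤ : ℕ∞) k) {α : Fin 4} (hα : α ≠ 3) (s : ℝ) (x : Spacetime) :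
    pd α (curvOff f k s) x = -(1 / 2) * pd α (pd 1 (pd 2 f)) x := by
  have h1 := (contDiff_pd (contDiff_pd hf 2) 1).differentiable (by simp) x
  have hK := contDiff_comp_coord hk 3
  have h2 := (contDiff_pd hK 3).differentiable (by simp) x
  have e : curvOff f k s
      = fun y => s / 2 * pd 3 (fun z => k (z 3)) y + -(1 / 2) * pd 1 (pd 2 f) y := by
    funext y
    simp only [curvOff]
    ring
  have z : pd α (fun z : Spacetime => k (z 3)) = fun _ => 0 :=
    funext (pd_comp_coord (hk.differentiable (by simp)) hα)
  rw [e, pd_add α (h2.const_mul _) (h1.const_mul _), pd_const_mul α _ h1, pd_const_mul α _ h2,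
    pd_comm hK, z, pd_const, mul_zero, zero_add]

lemma pd_zero_pd_pd {f : Spacetime → ℝ} (hf : ContDiff ℝ (⊤ : ℕ∞) f) (h0 : ∀ x, pd 0 f x = 0)
    (i j : Fin 4) (x : Spacetime) : pd 0 (pd i (pd j f)) x = 0 := by
  have h0' : pd 0 f = fun _ => 0 := funext h0
  have hj : pd 0 (pd j f) = fun _ => 0 := by
    funext y
    rw [pd_comm hf, h0', pd_const]
  rw [pd_comm (contDiff_pd hf j), hj, pd_const]

/-- Yang's equation for the curvature of the generalised pp-wave, in components. -/
lemma yang_equation {f : Spacetime → ℝ} (hf : ContDiff ℝ (⊤ : ℕ∞) f) {k : ℝ → ℝ}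
    (hk : ContDiff ℝ (⊤ : ℕ∞) k)
    (hlap : ∃ c : ℝ, ∀ x : Spacetime, pd 1 (pd 1 f) x + pd 2 (pd 2 f) x = c) (x : Spacetime) :
    pd 1 (curvDiag f k 1) x + pd 2 (curvOff f k (-1)) x = 0 ∧
      pd 1 (curvOff f k 1) x + pd 2 (curvDiag f k 2) x = 0 := by
  obtain ⟨c, hc⟩ := hlap
  have d : ∀ i, DifferentiableAt ℝ (pd i (pd i f)) x := fun i =>
    (contDiff_pd (contDiff_pd hf i) i).differentiable (by simp) x
  have h : ∀ α, pd α (pd 1 (pd 1 f)) x + pd α (pd 2 (pd 2 f)) x = 0 := by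
    intro α
    rw [← pd_add α (d 1) (d 2), funext hc, pd_const]
  rw [pd_curvDiag hf hk (by decide), pd_curvDiag hf hk (by decide), pd_curvOff hf hk (by decide),
    pd_curvOff hf hk (by decide), pd_comm (contDiff_pd hf 2) 2 1, funext (pd_comm hf 1 2),
    pd_comm (contDiff_pd hf 1) 1 2]
  constructor
  · linear_combination -(1 / 2) * h 1
  · linear_combination -(1 / 2) * h 2

lemma ymPair_nullCurv (f : Spacetime → ℝ) (x : Spacetime) (p q : Matrix (Fin 4) (Fin 4) ℝ)
    {G : Fin 4 → Fin 4 → Fin 4 → Fin 4 → ℝ} (hG : ∀ κ l μ ν, G κ l μ ν = -G κ l ν μ) :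
    ymPair f x (nullCurv p q) G
      = -2 * ∑ κ, ∑ l, (p κ l * G l κ 0 1 + q κ l * G l κ 0 2) := by
  simp only [ymPair, Finset.mul_sum]
  refine Finset.sum_congr rfl fun κ _ => Finset.sum_congr rfl fun l _ => ?_
  simp [Fin.sum_univ_four, nullCurv, ppMetricInv, hG l κ 1 0, hG l κ 2 0]
  ring

lemma ymPair_nullCurv_right (f : Spacetime → ℝ) (x : Spacetime) (p q : Matrix (Fin 4) (Fin 4) ℝ)
    {G : Fin 4 → Fin 4 → Fin 4 → Fin 4 → ℝ} (hG : ∀ κ l μ ν, G κ l μ ν = -G κ l ν μ) :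
    ymPair f x G (nullCurv p q)
      = -2 * ∑ κ, ∑ l, (p κ l * G l κ 0 1 + q κ l * G l κ 0 2) := by
  rw [Finset.sum_comm]
  simp only [ymPair, Finset.mul_sum]
  refine Finset.sum_congr rfl fun κ _ => Finset.sum_congr rfl fun l _ => ?_
  simp [Fin.sum_univ_four, nullCurv, ppMetricInv, hG κ l 1 0, hG κ l 2 0]
  ring

lemma curvLin_antisymm (A B : Spacetime → Fin 4 → Fin 4 → Fin 4 → ℝ) (x : Spacetime)
    (κ l μ ν : Fin 4) : curvLin A B x κ l μ ν = -curvLin A B x κ l ν μ := by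
  simp only [curvLin, Fin.sum_univ_four]
  ring

/-- The trace of the product of a null rotation field with the matrix `B_μ`. -/
def nullTrace (a b : Spacetime → ℝ) (B : Spacetime → Fin 4 → Fin 4 → Fin 4 → ℝ) (μ : Fin 4)
    (x : Spacetime) : ℝ :=
  a x * (B x 1 μ 0 + B x 3 μ 1) + b x * (B x 2 μ 0 + B x 3 μ 2)

lemma contDiff_nullTrace {a b : Spacetime → ℝ} (ha : ContDiff ℝ (⊤ : ℕ∞) a)
    (hb : ContDiff ℝ (⊤ : ℕ∞) b) {B : Spacetime → Fin 4 → Fin 4 → Fin 4 → ℝ}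
    (hB : ∀ κ μ ν, ContDiff ℝ (⊤ : ℕ∞) (fun x => B x κ μ ν)) (μ : Fin 4) :
    ContDiff ℝ (⊤ : ℕ∞) (nullTrace a b B μ) := by
  unfold nullTrace
  fun_prop

lemma hasCompactSupport_nullTrace (a b : Spacetime → ℝ)
    {B : Spacetime → Fin 4 → Fin 4 → Fin 4 → ℝ} (hBc : HasCompactSupport B) (μ : Fin 4) :
    HasCompactSupport (nullTrace a b B μ) :=
  HasCompactSupport.intro hBc.isCompact fun x hx => by
    simp [nullTrace, image_eq_zero_of_notMem_tsupport hx]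

lemma pd_nullTrace {a b : Spacetime → ℝ} (ha : ContDiff ℝ (⊤ : ℕ∞) a)
    (hb : ContDiff ℝ (⊤ : ℕ∞) b) {B : Spacetime → Fin 4 → Fin 4 → Fin 4 → ℝ}
    (hB : ∀ κ μ ν, ContDiff ℝ (⊤ : ℕ∞) (fun x => B x κ μ ν)) (α μ : Fin 4) (x : Spacetime) :
    pd α (nullTrace a b B μ) x
      = a x * (pd α (fun y => B y 1 μ 0) x + pd α (fun y => B y 3 μ 1) x)
        + (B x 1 μ 0 + B x 3 μ 1) * pd α a x
        + (b x * (pd α (fun y => B y 2 μ 0) x + pd α (fun y => B y 3 μ 2) x)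
        + (B x 2 μ 0 + B x 3 μ 2) * pd α b x) := by
  have da := ha.differentiable (by simp) x
  have db := hb.differentiable (by simp) x
  have dB := fun κ μ ν => (hB κ μ ν).differentiable (by simp) x
  unfold nullTrace
  rw [pd_add α (da.fun_mul ((dB 1 μ 0).fun_add (dB 3 μ 1)))
      (db.fun_mul ((dB 2 μ 0).fun_add (dB 3 μ 2))),
    pd_mul α da ((dB 1 μ 0).fun_add (dB 3 μ 1)), pd_mul α db ((dB 2 μ 0).fun_add (dB 3 μ 2)),
    pd_add α (dB 1 μ 0) (dB 3 μ 1), pd_add α (dB 2 μ 0) (dB 3 μ 2)]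

/-- The first-order variation of the Yang–Mills density is a divergence. -/
lemma firstVariation_eq_divergence {f : Spacetime → ℝ} (hf : ContDiff ℝ (⊤ : ℕ∞) f)
    (h0 : ∀ x, pd 0 f x = 0) {k : ℝ → ℝ} (hk : ContDiff ℝ (⊤ : ℕ∞) k)
    (hlap : ∃ c : ℝ, ∀ x : Spacetime, pd 1 (pd 1 f) x + pd 2 (pd 2 f) x = c)
    {B : Spacetime → Fin 4 → Fin 4 → Fin 4 → ℝ}
    (hB : ∀ κ μ ν, ContDiff ℝ (⊤ : ℕ∞) (fun x => B x κ μ ν)) (x : Spacetime) :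
    ymPair f x (curv (fullConn f k) x) (curvLin (fullConn f k) B x)
        + ymPair f x (curvLin (fullConn f k) B x) (curv (fullConn f k) x)
      = -4 * (pd 0 (nullTrace (curvDiag f k 1) (curvOff f k 1) B 1) x
          + pd 0 (nullTrace (curvOff f k (-1)) (curvDiag f k 2) B 2) x
          - pd 1 (nullTrace (curvDiag f k 1) (curvOff f k 1) B 0) x
          - pd 2 (nullTrace (curvOff f k (-1)) (curvDiag f k 2) B 0) x) := by
  have hD := contDiff_curvDiag hf hk
  have hO := contDiff_curvOff hf hk
  have zD : ∀ i, pd 0 (curvDiag f k i) x = 0 := fun i => by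
    rw [pd_curvDiag hf hk (by decide), pd_zero_pd_pd hf h0, mul_zero]
  have zO : ∀ s, pd 0 (curvOff f k s) x = 0 := fun s => by
    rw [pd_curvOff hf hk (by decide), pd_zero_pd_pd hf h0, mul_zero]
  obtain ⟨y1, y2⟩ := yang_equation hf hk hlap x
  rw [curv_fullConn hf h0 hk, ymPair_nullCurv _ _ _ _ (curvLin_antisymm _ _ _),
    ymPair_nullCurv_right _ _ _ _ (curvLin_antisymm _ _ _),
    pd_nullTrace (hD 1) (hO 1) hB, pd_nullTrace (hO (-1)) (hD 2) hB,
    pd_nullTrace (hD 1) (hO 1) hB, pd_nullTrace (hO (-1)) (hD 2) hB, zD, zD, zO, zO]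
  simp [Fin.sum_univ_four, nullRot, curvLin, fullConn_eq h0, ppConnMatrix]
  linear_combination -4 * (B x 1 0 0 + B x 3 0 1) * y1 - 4 * (B x 2 0 0 + B x 3 0 2) * y2

lemma integral_firstVariation {f : Spacetime → ℝ} (hf : ContDiff ℝ (⊤ : ℕ∞) f)
    (h0 : ∀ x, pd 0 f x = 0) {k : ℝ → ℝ} (hk : ContDiff ℝ (⊤ : ℕ∞) k)
    (hlap : ∃ c : ℝ, ∀ x : Spacetime, pd 1 (pd 1 f) x + pd 2 (pd 2 f) x = c)
    {B : Spacetime → Fin 4 → Fin 4 → Fin 4 → ℝ}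
    (hB : ∀ κ μ ν, ContDiff ℝ (⊤ : ℕ∞) (fun x => B x κ μ ν)) (hBc : HasCompactSupport B) :
    ∫ x, (ymPair f x (curv (fullConn f k) x) (curvLin (fullConn f k) B x)
      + ymPair f x (curvLin (fullConn f k) B x) (curv (fullConn f k) x)) = 0 := by
  have hD := contDiff_curvDiag hf hk
  have hO := contDiff_curvOff hf hk
  have s1 := contDiff_nullTrace (hD 1) (hO 1) hB
  have s2 := contDiff_nullTrace (hO (-1)) (hD 2) hB
  have c1 := hasCompactSupport_nullTrace (curvDiag f k 1) (curvOff f k 1) hBc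
  have c2 := hasCompactSupport_nullTrace (curvOff f k (-1)) (curvDiag f k 2) hBc
  have j0 : Integrable fun x => pd 0 (nullTrace (curvDiag f k 1) (curvOff f k 1) B 1) x
      + pd 0 (nullTrace (curvOff f k (-1)) (curvDiag f k 2) B 2) x :=
    (integrable_pd (s1 1) (c1 1) 0).add (integrable_pd (s2 2) (c2 2) 0)
  have j1 : Integrable fun x => pd 0 (nullTrace (curvDiag f k 1) (curvOff f k 1) B 1) x
      + pd 0 (nullTrace (curvOff f k (-1)) (curvDiag f k 2) B 2) x
      - pd 1 (nullTrace (curvDiag f k 1) (curvOff f k 1) B 0) x :=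
    j0.sub (integrable_pd (s1 0) (c1 0) 1)
  simp only [firstVariation_eq_divergence hf h0 hk hlap hB]
  rw [integral_const_mul, integral_sub j1 (integrable_pd (s2 0) (c2 0) 2),
    integral_sub j0 (integrable_pd (s1 0) (c1 0) 1),
    integral_add (integrable_pd (s1 1) (c1 1) 0) (integrable_pd (s2 2) (c2 2) 0)]
  simp [integral_pd_eq_zero (s1 _) (c1 _), integral_pd_eq_zero (s2 _) (c2 _)]

/-- Main Theorem, connection variation: if ∂₁²f + ∂₂²f is constant,
then the Yang–Mills action is stationary at the full connection of the generalised
pp-wave with purely axial torsion, under compactly supported variations of the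
connection. -/
theorem main_theorem_connection_variation
    (f : Spacetime → ℝ) (hf : ContDiff ℝ (⊤ : ℕ∞) f) (h0 : ∀ x, pd 0 f x = 0)
    (k : ℝ → ℝ) (hk : ContDiff ℝ (⊤ : ℕ∞) k)
    (hlap : ∃ c : ℝ, ∀ x : Spacetime, pd 1 (pd 1 f) x + pd 2 (pd 2 f) x = c)
    (B : Spacetime → Fin 4 → Fin 4 → Fin 4 → ℝ)
    (hB : ∀ κ μ ν, ContDiff ℝ (⊤ : ℕ∞) (fun x => B x κ μ ν))
    (hBc : HasCompactSupport B) :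
    HasDerivAt (fun t : ℝ =>
      ∫ x : Spacetime,
        (qYM f (fun y κ μ ν => fullConn f k y κ μ ν + t * B y κ μ ν) x
          - qYM f (fullConn f k) x)) 0 0 := by
  exact hasDerivAt_action hf (contDiff_fullConn hf hk) hB hBc
    (integral_firstVariation hf h0 hk hlap hB hBc)
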